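/- Let A = ℂ[x_1, x_2, x_3], f_7 = (x_1·x_3 + x_2)·(x_1^7 − x_2^7), and g_j = ∂f_7/∂x_j for j = 1, 2, 3. Then ker φ = (ker^{(1)}φ : f_7), i.e. for every p ∈ A[s, ξ_1, ξ_2, ξ_3] one has p ∈ ker φ if and only if f_7·p ∈ ker^{(1)}φ. -/

import Mathlib

open MvPolynomial

set_option synthInstance.maxHeartbeats 1000000
set_option maxHeartbeats 1000000

/-- The `A`-algebra map `φ : A[s, ξ_1, …, ξ_n] → A[t]` with `φ(s) = f·t` and
`φ(ξ_j) = g_j·t`; variable `0` is `s` and variable `j.succ` is `ξ_j`. Its image is the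
Rees algebra of the ideal `(f, g_1, …, g_n)`. -/
noncomputable def reesPhi {A : Type*} [CommRing A] {n : ℕ} (f : A) (g : Fin n → A) :
    MvPolynomial (Fin (n + 1)) A →ₐ[A] Polynomial A :=
  aeval (Fin.cons (Polynomial.C f * Polynomial.X) fun j => Polynomial.C (g j) * Polynomial.X)

/-- `ker^{(1)} φ`: the ideal of `A[s, ξ_1, …, ξ_n]` generated by the homogeneous
elements of degree `1` lying in `ker φ`. -/
noncomputable def kerOne {A : Type*} [CommRing A] {n : ℕ} (f : A) (g : Fin n → A) :
    Ideal (MvPolynomial (Fin (n + 1)) A) :=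
  Ideal.span {p | p ∈ RingHom.ker (reesPhi f g) ∧ p.IsHomogeneous 1}

/-- The member `k = 7` of the family `D_k`: `f_7 = (x_1·x_3 + x_2)·(x_1^7 − x_2^7)` in
`ℂ[x_1, x_2, x_3]`. -/
noncomputable def fD7 : MvPolynomial (Fin 3) ℂ :=
  (X 0 * X 2 + X 1) * (X 0 ^ 7 - X 1 ^ 7)

/-- The polynomial ring `ℂ[x_1, x_2, x_3]`. -/
abbrev BaseRing : Type := MvPolynomial (Fin 3) ℂ

/-- The polynomial ring `ℂ[x_1, x_2, x_3][s, ξ_1, ξ_2, ξ_3]`. -/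
abbrev FormRing : Type := MvPolynomial (Fin 4) BaseRing

/-- The linear form with coefficient vector `c`. -/
noncomputable def linForm (c : Fin 4 → BaseRing) : FormRing := ∑ i, C (c i) * X i

lemma linForm_isHomogeneous (c : Fin 4 → BaseRing) : (linForm c).IsHomogeneous 1 :=
  IsHomogeneous.sum _ _ _ fun i _ => isHomogeneous_C_mul_X (c i) i

/-- The relation given by the Euler field `x_1 ∂_1 + x_2 ∂_2`. -/
noncomputable def eulerRel : FormRing := linForm ![-8, X 0, X 1, 0]

/-- The relation given by the logarithmic field `(x_1 x_3 + x_2) ∂_3`. -/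
noncomputable def vertRel : FormRing := linForm ![-X 0, 0, 0, X 0 * X 2 + X 1]

/-- The relation given by the logarithmic field
`x_2^6 ∂_1 + x_1^6 ∂_2 - x_1^5 (1 + x_3^7) ∂_3`. -/
noncomputable def mixedRel : FormRing :=
  linForm ![-(X 2 * (X 1 ^ 5 - X 1 ^ 4 * (X 0 * X 2) + X 1 ^ 3 * (X 0 * X 2) ^ 2
      - X 1 ^ 2 * (X 0 * X 2) ^ 3 + X 1 * (X 0 * X 2) ^ 4 - (X 0 * X 2) ^ 5)),
    X 1 ^ 6, X 0 ^ 6, -(X 0 ^ 5 * (1 + X 2 ^ 7))]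

/-- The ideal generated by the three relations of the Saito basis. -/
noncomputable def saitoIdeal : Ideal FormRing := Ideal.span {eulerRel, vertRel, mixedRel}

/-- The linear form `8 ξ_3 - x_1 ξ_2`, a nonzerodivisor modulo `saitoIdeal`. -/
noncomputable def pivot : FormRing := 8 * X 3 - C (X 0) * X 2

lemma eulerRel_eq : eulerRel = C (X 0) * X 1 + C (X 1) * X 2 - 8 * X 0 := by
  have h8 : (C 8 : FormRing) = 8 := map_ofNat C 8
  simp [eulerRel, linForm, Fin.sum_univ_four, h8]
  ring

lemma vertRel_eq :
    vertRel = (C (X 0) * C (X 2) + C (X 1)) * X 3 - C (X 0) * X 0 := by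
  simp [vertRel, linForm, Fin.sum_univ_four]
  ring

lemma mixedRel_eq :
    mixedRel = C (X 1) ^ 6 * X 1 + C (X 0) ^ 6 * X 2 - C (X 0) ^ 5 * (1 + C (X 2) ^ 7) * X 3
      - C (X 2) * (C (X 1) ^ 5 - C (X 1) ^ 4 * (C (X 0) * C (X 2))
        + C (X 1) ^ 3 * (C (X 0) * C (X 2)) ^ 2 - C (X 1) ^ 2 * (C (X 0) * C (X 2)) ^ 3
        + C (X 1) * (C (X 0) * C (X 2)) ^ 4 - (C (X 0) * C (X 2)) ^ 5) * X 0 := by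
  simp [mixedRel, linForm, Fin.sum_univ_four]
  ring

lemma pderiv_zero_fD7 :
    pderiv 0 fD7 = X 2 * (X 0 ^ 7 - X 1 ^ 7) + 7 * (X 0 * X 2 + X 1) * X 0 ^ 6 := by
  simp [fD7, pderiv_X, Derivation.leibniz_pow]
  ring

lemma pderiv_one_fD7 :
    pderiv 1 fD7 = (X 0 ^ 7 - X 1 ^ 7) - 7 * (X 0 * X 2 + X 1) * X 1 ^ 6 := by
  simp [fD7, pderiv_X, Derivation.leibniz_pow]
  ring

lemma pderiv_two_fD7 : pderiv 2 fD7 = X 0 * (X 0 ^ 7 - X 1 ^ 7) := by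
  simp [fD7, pderiv_X, Derivation.leibniz_pow]
  ring

section ReesMap

variable {A : Type*} [CommRing A] {n : ℕ} (f : A) (g : Fin n → A)

lemma reesPhi_X_zero : reesPhi f g (X 0) = Polynomial.C f * Polynomial.X := by
  simp [reesPhi]

lemma reesPhi_X_succ (j : Fin n) :
    reesPhi f g (X j.succ) = Polynomial.C (g j) * Polynomial.X := by
  simp [reesPhi]

lemma reesPhi_C (a : A) : reesPhi f g (C a) = Polynomial.C a :=
  (reesPhi f g).commutes a

lemma kerOne_le_ker : kerOne f g ≤ RingHom.ker (reesPhi f g) :=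
  Ideal.span_le.2 fun _ hp => hp.1

/-- A ring homomorphism inverting `f` and killing all `f ξ_j - g_j s` factors through `φ`. -/
lemma map_eq_zero_of_mem_ker {S : Type*} [CommRing S] (π : MvPolynomial (Fin (n + 1)) A →+* S)
    (hf : IsUnit (π (C f))) (hg : ∀ j : Fin n, π (C f * X j.succ) = π (C (g j) * X 0))
    {p : MvPolynomial (Fin (n + 1)) A} (hp : p ∈ RingHom.ker (reesPhi f g)) : π p = 0 := by
  obtain ⟨v, hv⟩ := hf.exists_left_inv
  have h : π = (Polynomial.eval₂RingHom (π.comp C) (v * π (X 0))).comp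
      (reesPhi f g : MvPolynomial (Fin (n + 1)) A →+* Polynomial A) := by
    refine MvPolynomial.ringHom_ext (fun a => ?_) fun i => ?_
    · simp
    · refine Fin.cases ?_ (fun j => ?_) i
      · simp [reesPhi_X_zero]
        linear_combination (-π (X 0)) * hv
      · have := hg j
        simp only [map_mul] at this
        simp [reesPhi_X_succ]
        linear_combination (-π (X j.succ)) * hv + v * this
  rw [h, RingHom.comp_apply]
  simp [show reesPhi f g p = 0 from hp]

end ReesMap

/-- If `p` vanishes in every `R ⧸ J`-algebra in which `u` is invertible, a power of `u`
multiplies `p` into `J`. -/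
lemma exists_pow_mul_mem.{u} {R : Type u} [CommRing R] (J : Ideal R) (u p : R)
    (h : ∀ (S : Type u) [CommRing S] (π : R →+* S), (∀ q ∈ J, π q = 0) → IsUnit (π u) → π p = 0) :
    ∃ N : ℕ, u ^ N * p ∈ J := by
  have h0 := h (Localization.Away (Ideal.Quotient.mk J u))
    ((algebraMap (R ⧸ J) (Localization.Away (Ideal.Quotient.mk J u))).comp (Ideal.Quotient.mk J))
    (fun q hq => by rw [RingHom.comp_apply, Ideal.Quotient.eq_zero_iff_mem.2 hq, map_zero])
    (IsLocalization.Away.algebraMap_isUnit (Ideal.Quotient.mk J u))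
  obtain ⟨⟨_, N, rfl⟩, hc⟩ := (IsLocalization.map_eq_zero_iff
    (Submonoid.powers (Ideal.Quotient.mk J u)) _ _).1 h0
  refine ⟨N, ?_⟩
  rw [← Ideal.Quotient.eq_zero_iff_mem]
  simpa using hc

lemma eulerRel_mem : eulerRel ∈ saitoIdeal := Ideal.subset_span (by simp)

lemma vertRel_mem : vertRel ∈ saitoIdeal := Ideal.subset_span (by simp)

lemma mixedRel_mem : mixedRel ∈ saitoIdeal := Ideal.subset_span (by simp)

lemma saitoIdeal_le_kerOne : saitoIdeal ≤ kerOne fD7 fun j => pderiv j fD7 := by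
  have h0 := reesPhi_X_zero fD7 fun j => pderiv j fD7
  have hX := reesPhi_X_succ fD7 fun j => pderiv j fD7
  have h1 := hX 0
  have h2 := hX 1
  have h3 := hX 2
  have hC := reesPhi_C fD7 fun j => pderiv j fD7
  rw [pderiv_zero_fD7, Fin.succ_zero_eq_one] at h1
  rw [pderiv_one_fD7, Fin.succ_one_eq_two] at h2
  rw [pderiv_two_fD7, show (2 : Fin 3).succ = 3 from rfl] at h3
  refine Ideal.span_le.2 ?_
  rintro p hp
  refine Ideal.subset_span ⟨?_, by
    rcases hp with rfl | rfl | rfl <;> exact linForm_isHomogeneous _⟩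
  rw [RingHom.mem_ker]
  clear hX
  generalize reesPhi fD7 (fun j => pderiv j fD7) = ψ at *
  rcases hp with rfl | rfl | rfl
  · rw [eulerRel_eq]
    simp only [map_add, map_sub, map_mul, map_ofNat, h0, h1, h2, hC, fD7, map_pow]
    ring
  · rw [vertRel_eq]
    simp only [map_add, map_sub, map_mul, h0, h3, hC, fD7, map_pow]
    ring
  · rw [mixedRel_eq]
    simp only [map_add, map_sub, map_mul, map_ofNat, h0, h1, h2, h3, hC, fD7, map_pow,
      map_one]
    ring

lemma fD7_mul_sub_mem (j : Fin 3) :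
    C fD7 * X j.succ - C (pderiv j fD7) * X 0 ∈ saitoIdeal := by
  fin_cases j
  · change C fD7 * X 1 - C (pderiv 0 fD7) * X 0 ∈ saitoIdeal
    have : C fD7 * X 1 - C (pderiv 0 fD7) * X 0
        = (C (X 0) * C (X 2) + C (X 1)) * C (X 0) ^ 6 * eulerRel
          - C (X 1) * C (X 0) ^ 5 * (1 + C (X 2) ^ 7) * vertRel
          - (C (X 0) * C (X 2) + C (X 1)) * C (X 1) * mixedRel := by
      rw [eulerRel_eq, vertRel_eq, mixedRel_eq, pderiv_zero_fD7]
      simp only [fD7, map_add, map_sub, map_mul, map_pow, map_ofNat]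
      ring
    rw [this]
    exact sub_mem (sub_mem (Ideal.mul_mem_left _ _ eulerRel_mem)
      (Ideal.mul_mem_left _ _ vertRel_mem)) (Ideal.mul_mem_left _ _ mixedRel_mem)
  · change C fD7 * X 2 - C (pderiv 1 fD7) * X 0 ∈ saitoIdeal
    have : C fD7 * X 2 - C (pderiv 1 fD7) * X 0
        = -(C (X 0) * C (X 2) + C (X 1)) * C (X 1) ^ 6 * eulerRel
          + C (X 0) * C (X 0) ^ 5 * (1 + C (X 2) ^ 7) * vertRel
          + (C (X 0) * C (X 2) + C (X 1)) * C (X 0) * mixedRel := by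
      rw [eulerRel_eq, vertRel_eq, mixedRel_eq, pderiv_one_fD7]
      simp only [fD7, map_add, map_sub, map_mul, map_pow, map_ofNat]
      ring
    rw [this]
    exact add_mem (add_mem (Ideal.mul_mem_left _ _ eulerRel_mem)
      (Ideal.mul_mem_left _ _ vertRel_mem)) (Ideal.mul_mem_left _ _ mixedRel_mem)
  · change C fD7 * X 3 - C (pderiv 2 fD7) * X 0 ∈ saitoIdeal
    have : C fD7 * X 3 - C (pderiv 2 fD7) * X 0
        = (C (X 0) ^ 7 - C (X 1) ^ 7) * vertRel := by
      rw [vertRel_eq, pderiv_two_fD7]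
      simp only [fD7, map_add, map_sub, map_mul, map_pow]
      ring
    rw [this]
    exact Ideal.mul_mem_left _ _ vertRel_mem

lemma exists_pow_fD7_mul_mem {p : FormRing}
    (hp : p ∈ RingHom.ker (reesPhi fD7 fun j => pderiv j fD7)) :
    ∃ N : ℕ, C fD7 ^ N * p ∈ saitoIdeal := by
  refine exists_pow_mul_mem _ _ _ fun S _ π hπ hu => ?_
  refine map_eq_zero_of_mem_ker fD7 (fun j => pderiv j fD7) π hu (fun j => ?_) hp
  rw [← sub_eq_zero, ← map_sub]
  exact hπ _ (fD7_mul_sub_mem j)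

lemma eight_mul_C_C_inv : (8 : FormRing) * C (C 8⁻¹) = 1 := by
  rw [← map_ofNat (C : BaseRing →+* FormRing) 8, ← map_ofNat (C : ℂ →+* BaseRing) 8,
    ← map_mul, ← map_mul]
  norm_num

section Chart

/-- Coordinate ring of a chart resolving the relations; its variables `X 0, …, X 4` are
`x`, `Y`, `a`, `b`, `w`. -/
abbrev ChartRing : Type := MvPolynomial (Fin 5) ℂ

/-- The chart `x_1 = x`, `x_2 = x Y`, `x_3 = a x - Y`, `ξ_2 = b`, `ξ_3 = w`, on which the Euler
relation and `vertRel` vanish identically. -/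
noncomputable def chart : FormRing →+* ChartRing :=
  eval₂Hom (aeval ![X 0, X 0 * X 1, X 2 * X 0 - X 1] : BaseRing →ₐ[ℂ] ChartRing).toRingHom
    ![X 0 * X 2 * X 4, 8 * X 2 * X 4 - X 3 * X 1, X 3, X 4]

lemma chart_C_C (c : ℂ) : chart (C (C c)) = C c := by simp [chart, algebraMap_eq]

lemma chart_C_X (i : Fin 3) :
    chart (C (X i)) = (![X 0, X 0 * X 1, X 2 * X 0 - X 1] : Fin 3 → ChartRing) i := by
  simp [chart]

lemma chart_X (i : Fin 4) : chart (X i) =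
    (![X 0 * X 2 * X 4, 8 * X 2 * X 4 - X 3 * X 1, X 3, X 4] : Fin 4 → ChartRing) i := by
  simp [chart]

/-- The equation of the strict transform of `mixedRel` in the chart. -/
noncomputable def strictRel : ChartRing :=
  (1 - X 1 ^ 7) * (X 0 * X 3 - X 4) + 7 * (X 0 * X 2 * X 4 * X 1 ^ 6)

lemma chart_eulerRel : chart eulerRel = 0 := by
  have h8 : chart 8 = 8 := map_ofNat chart 8
  rw [eulerRel_eq]
  simp [chart_C_X, chart_X, h8]
  ring

lemma chart_vertRel : chart vertRel = 0 := by
  rw [vertRel_eq]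
  simp [chart_C_X, chart_X]
  ring

lemma chart_mixedRel : chart mixedRel = X 0 ^ 5 * strictRel := by
  rw [mixedRel_eq]
  simp [chart_C_X, chart_X, strictRel]
  ring

lemma chart_fD7 : chart (C fD7) = X 0 ^ 9 * X 2 * (1 - X 1 ^ 7) := by
  simp [fD7, chart_C_X]
  ring

lemma dvd_chart_of_mem {p : FormRing} (hp : p ∈ saitoIdeal) :
    X 0 ^ 5 * strictRel ∣ chart p := by
  rw [← chart_mixedRel, ← Ideal.mem_span_singleton]
  suffices saitoIdeal ≤ (Ideal.span {chart mixedRel}).comap chart from this hp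
  refine Ideal.span_le.2 ?_
  rintro q (rfl | rfl | rfl)
  · simp [chart_eulerRel]
  · simp [chart_vertRel]
  · exact Ideal.mem_span_singleton_self _

/-- Inverting `pivot` makes the chart an isomorphism modulo `eulerRel` and `vertRel`; hence the
image of `saitoIdeal` is generated by `chart mixedRel` there. -/
lemma map_eq_zero_of_dvd_chart {S : Type*} [CommRing S] (π : FormRing →+* S)
    (hπ : ∀ q ∈ saitoIdeal, π q = 0) (hu : IsUnit (π pivot)) {p : FormRing}
    (hp : X 0 ^ 5 * strictRel ∣ chart p) : π p = 0 := by
  obtain ⟨v, hv⟩ := hu.exists_left_inv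
  have h1 := hπ _ eulerRel_mem
  have h2 := hπ _ vertRel_mem
  rw [eulerRel_eq] at h1
  rw [vertRel_eq] at h2
  simp only [pivot, map_add, map_sub, map_mul, map_ofNat] at h1 h2 hv
  obtain ⟨k, hk⟩ : ∃ k : S, k * 8 = 1 :=
    ⟨π (C (C 8⁻¹)), by rw [← map_ofNat π 8, ← map_mul, mul_comm, eight_mul_C_C_inv, map_one]⟩
  let a : S := v * (π (X 1) - π (C (X 2)) * π (X 2))
  let σ : ChartRing →+* S := eval₂Hom (π.comp (C.comp C))
    ![π (C (X 0)), a * π (C (X 0)) - π (C (X 2)), a, π (X 2), π (X 3)]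
  have hσ : π = σ.comp chart := by
    refine MvPolynomial.ringHom_ext (fun c => ?_) fun i => ?_
    · refine congrFun (congrArg DFunLike.coe (?_ : π.comp C = (σ.comp chart).comp C)) c
      refine MvPolynomial.ringHom_ext (fun c => ?_) fun i => ?_
      · simp [σ, chart_C_C]
      · fin_cases i
        · simp [σ, chart_C_X]
        · simp [σ, chart_C_X, a]
          linear_combination (-(π (C (X 0)) * π (C (X 2)) + π (C (X 1)))) * hv + 8 * v * h2
            - v * π (C (X 0)) * h1
        · simp [σ, chart_C_X]
    · fin_cases i
      · simp [σ, chart_X, a]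
        linear_combination k * (-8 * π (X 0) * hv
            + v * (-(8 * π (X 3) - π (C (X 0)) * π (X 2)) * h1 + 8 * π (X 2) * h2
              - π (X 2) * π (C (X 0)) * h1))
          - (π (X 0) - v * π (C (X 0)) * (π (X 1) - π (C (X 2)) * π (X 2)) * π (X 3)) * hk
      · have h8 : σ 8 = 8 := map_ofNat σ 8
        simp [chart_X, h8]
        simp [σ, a]
        linear_combination (-(π (X 1) - π (C (X 2)) * π (X 2))) * hv
      · simp [σ, chart_X]
      · simp [σ, chart_X]
  obtain ⟨u, hu⟩ := hp
  rw [hσ, RingHom.comp_apply, hu, ← chart_mixedRel, map_mul, ← RingHom.comp_apply, ← hσ,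
    hπ _ mixedRel_mem, zero_mul]

lemma isRelPrime_X_of_eval {τ : Type*} (i : τ) {q : MvPolynomial τ ℂ} (v : τ → ℂ)
    (hv : v i = 0) (hq : eval v q ≠ 0) : IsRelPrime q (X i) := by
  refine ((X_prime (i := i)).irreducible.isRelPrime_iff_not_dvd.2 ?_).symm
  rintro ⟨t, rfl⟩
  simp [hv] at hq

lemma isRelPrime_strictRel_chart_fD7 : IsRelPrime strictRel (chart (C fD7)) := by
  have hx : IsRelPrime strictRel (X 0) :=
    isRelPrime_X_of_eval 0 ![0, 0, 0, 0, 1] (by simp) (by simp [strictRel])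
  have ha : IsRelPrime strictRel (X 2) :=
    isRelPrime_X_of_eval 2 ![0, 0, 0, 0, 1] (by simp) (by simp [strictRel])
  have hX (i : Fin 5) : IsRelPrime (1 - X 1 ^ 7 : ChartRing) (X i) :=
    isRelPrime_X_of_eval i 0 (by simp) (by simp)
  have h7 : IsUnit (7 : ChartRing) := by
    rw [← map_ofNat C 7]
    exact (IsUnit.mk0 (7 : ℂ) (by norm_num)).map C
  have hh : IsRelPrime strictRel (1 - X 1 ^ 7) := by
    have : IsRelPrime (1 - X 1 ^ 7 : ChartRing) (7 * (X 0 * X 2 * X 4 * X 1 ^ 6)) :=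
      (h7.isRelPrime_right).mul_right
        ((((hX 0).mul_right (hX 2)).mul_right (hX 4)).mul_right (hX 1).pow_right)
    intro d hd hd'
    exact this hd' ((dvd_add_right (hd'.mul_right _)).1 hd)
  rw [chart_fD7]
  exact ((hx.pow_right).mul_right ha).mul_right hh

end Chart

lemma exists_pow_pivot_mul_mem {p : FormRing}
    (hp : p ∈ RingHom.ker (reesPhi fD7 fun j => pderiv j fD7)) :
    ∃ N : ℕ, pivot ^ N * (C fD7 * p) ∈ saitoIdeal := by
  obtain ⟨N, hN⟩ := exists_pow_fD7_mul_mem hp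
  have h := (Dvd.intro_left _ rfl).trans (dvd_chart_of_mem hN)
  rw [map_mul, map_pow] at h
  have hρ : strictRel ∣ chart p :=
    (isRelPrime_strictRel_chart_fD7.pow_right).dvd_of_dvd_mul_left h
  refine exists_pow_mul_mem _ _ _ fun S _ π hπ hu => map_eq_zero_of_dvd_chart π hπ hu ?_
  rw [map_mul, chart_fD7]
  exact mul_dvd_mul ⟨X 0 ^ 4 * X 2 * (1 - X 1 ^ 7), by ring⟩ hρ

section Pivot

/-- An algebra endomorphism fixing the variables modulo `J` is the identity modulo `J`. -/
lemma sub_map_mem {σ A : Type*} [CommRing A] (J : Ideal (MvPolynomial σ A))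
    (η : MvPolynomial σ A →ₐ[A] MvPolynomial σ A) (h : ∀ i, X i - η (X i) ∈ J)
    (p : MvPolynomial σ A) : p - η p ∈ J := by
  have : (Ideal.Quotient.mkₐ A J).comp η = Ideal.Quotient.mkₐ A J :=
    MvPolynomial.algHom_ext fun i => (Ideal.Quotient.eq.2 (h i)).symm
  exact Ideal.Quotient.eq.1 (DFunLike.congr_fun this p).symm

/-- Elimination of `ξ_3` by means of `pivot = 0`. -/
noncomputable def elimPivot : FormRing →ₐ[BaseRing] FormRing :=
  aeval ![X 0, X 1, X 2, C (C 8⁻¹) * C (X 0) * X 2]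

/-- Elimination of `s` and `ξ_3` by means of `eulerRel = 0` and `pivot = 0`. -/
noncomputable def elimBoth : FormRing →ₐ[BaseRing] FormRing :=
  aeval ![C (C 8⁻¹) * (C (X 0) * X 1 + C (X 1) * X 2), X 1, X 2, C (C 8⁻¹) * C (X 0) * X 2]

/-- Elimination of `ξ_1` by means of `ξ_1 = x_3 ξ_2`. -/
noncomputable def elimFirst : FormRing →ₐ[BaseRing] FormRing :=
  aeval ![X 0, C (X 2) * X 2, X 2, X 3]

lemma pivot_dvd_of_elimPivot_eq_zero {p : FormRing} (hp : elimPivot p = 0) : pivot ∣ p := by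
  rw [← Ideal.mem_span_singleton, ← sub_zero p, ← hp]
  refine sub_map_mem _ _ (fun i => ?_) p
  rw [Ideal.mem_span_singleton]
  fin_cases i
  · simp [elimPivot]
  · simp [elimPivot]
  · simp [elimPivot]
  · refine ⟨C (C 8⁻¹), ?_⟩
    simp only [elimPivot, aeval_X, pivot]
    change X 3 - C (C 8⁻¹) * C (X 0) * X 2 = _
    linear_combination (-X 3) * eight_mul_C_C_inv

lemma exists_sub_elimBoth_eq (p : FormRing) :
    ∃ u v, u * eulerRel + v * pivot = p - elimBoth p := by
  rw [← Ideal.mem_span_pair]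
  refine sub_map_mem _ _ (fun i => ?_) p
  rw [Ideal.mem_span_pair]
  fin_cases i
  · refine ⟨-C (C 8⁻¹), 0, ?_⟩
    simp only [elimBoth, aeval_X, eulerRel_eq]
    change _ = X 0 - C (C 8⁻¹) * (C (X 0) * X 1 + C (X 1) * X 2)
    linear_combination X 0 * eight_mul_C_C_inv
  · exact ⟨0, 0, by simp [elimBoth]⟩
  · exact ⟨0, 0, by simp [elimBoth]⟩
  · refine ⟨0, C (C 8⁻¹), ?_⟩
    simp only [elimBoth, aeval_X, pivot]
    change _ = X 3 - C (C 8⁻¹) * C (X 0) * X 2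
    linear_combination X 3 * eight_mul_C_C_inv

lemma elimFirst_eq_zero_iff {p : FormRing} :
    elimFirst p = 0 ↔ X 1 - C (X 2) * X 2 ∣ p := by
  constructor
  · intro hp
    rw [← Ideal.mem_span_singleton, ← sub_zero p, ← hp]
    refine sub_map_mem _ _ (fun i => ?_) p
    rw [Ideal.mem_span_singleton]
    fin_cases i <;> simp [elimFirst]
  · rintro ⟨q, rfl⟩
    simp [elimFirst]

/-- Evaluation at a point of `ℂ³ × ℂ⁴`. -/
noncomputable def evalPoint (v : Fin 3 → ℂ) (w : Fin 4 → ℂ) : FormRing →+* ℂ :=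
  eval₂Hom (eval v) w

lemma evalPoint_C (v : Fin 3 → ℂ) (w : Fin 4 → ℂ) (a : BaseRing) :
    evalPoint v w (C a) = eval v a := by simp [evalPoint]

lemma evalPoint_X (v : Fin 3 → ℂ) (w : Fin 4 → ℂ) (i : Fin 4) :
    evalPoint v w (X i) = w i := by simp [evalPoint]

lemma prime_sub : Prime (X 1 - C (X 2) * X 2 : FormRing) := by
  refine ⟨fun h => ?_, fun h => ?_, fun p q h => ?_⟩
  · have := congrArg (evalPoint 0 ![0, 1, 0, 0]) h
    simp [evalPoint_C, evalPoint_X] at this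
  · have := h.map elimFirst
    rw [elimFirst_eq_zero_iff.2 dvd_rfl] at this
    exact not_isUnit_zero this
  · simp only [← elimFirst_eq_zero_iff, map_mul, mul_eq_zero] at h ⊢
    exact h

lemma isRelPrime_of_evalPoint {r q : FormRing} (hr : Prime r) (v : Fin 3 → ℂ) (w : Fin 4 → ℂ)
    (hv : evalPoint v w r = 0) (hq : evalPoint v w q ≠ 0) : IsRelPrime r q := by
  refine hr.irreducible.isRelPrime_iff_not_dvd.2 ?_
  rintro ⟨t, rfl⟩
  simp [hv] at hq

lemma elimBoth_eulerRel : elimBoth eulerRel = 0 := by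
  rw [eulerRel_eq]
  simp only [elimBoth, map_sub, map_add, map_mul, map_ofNat, aeval_X, algHom_C, algebraMap_eq]
  change C (X 0) * X 1 + C (X 1) * X 2
    - 8 * (C (C 8⁻¹) * (C (X 0) * X 1 + C (X 1) * X 2)) = 0
  linear_combination (-(C (X 0) * X 1 + C (X 1) * X 2)) * eight_mul_C_C_inv

lemma elimBoth_vertRel : elimBoth vertRel * (-8) = C (X 0) ^ 2 * (X 1 - C (X 2) * X 2) := by
  rw [vertRel_eq]
  simp only [elimBoth, map_sub, map_add, map_mul, aeval_X, algHom_C, algebraMap_eq]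
  change ((C (X 0) * C (X 2) + C (X 1)) * (C (C 8⁻¹) * C (X 0) * X 2)
    - C (X 0) * (C (C 8⁻¹) * (C (X 0) * X 1 + C (X 1) * X 2))) * (-8) = _
  linear_combination (C (X 0) ^ 2 * (X 1 - C (X 2) * X 2)) * eight_mul_C_C_inv

lemma elimBoth_pivot : elimBoth pivot = 0 := by
  simp only [elimBoth, pivot, map_sub, map_mul, map_ofNat, aeval_X, algHom_C, algebraMap_eq]
  change 8 * (C (C 8⁻¹) * C (X 0) * X 2) - C (X 0) * X 2 = 0
  linear_combination C (X 0) * X 2 * eight_mul_C_C_inv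

lemma elimBoth_elimBoth (p : FormRing) : elimBoth (elimBoth p) = elimBoth p := by
  obtain ⟨u, v, h⟩ := exists_sub_elimBoth_eq p
  have := congrArg elimBoth h
  rw [map_add, map_mul, map_mul, map_sub, elimBoth_eulerRel, elimBoth_pivot] at this
  linear_combination this

lemma elimBoth_vertRel_ne_zero : elimBoth vertRel ≠ 0 := by
  intro h
  have h' := elimBoth_vertRel
  have h2 := congrArg (evalPoint 1 ![0, 1, 0, 0]) h'
  rw [h] at h2
  simp [evalPoint_C, evalPoint_X] at h2

lemma isRelPrime_elimBoth : IsRelPrime (elimBoth vertRel) (elimBoth mixedRel) := by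
  have hx : IsRelPrime (C (X 0) : FormRing) (elimBoth mixedRel) := by
    refine isRelPrime_of_evalPoint ?_ ![0, 1, 0] ![0, 1, 0, 0] ?_ ?_
    · exact (MvPolynomial.prime_C_iff (Fin 4)).2 X_prime
    · simp [evalPoint_C]
    · rw [mixedRel_eq]
      simp [elimBoth, evalPoint_C, evalPoint_X]
  have ha : IsRelPrime (X 1 - C (X 2) * X 2 : FormRing) (elimBoth mixedRel) := by
    refine isRelPrime_of_evalPoint prime_sub ![1, 0, 0] ![0, 0, 1, 0] ?_ ?_
    · simp [evalPoint_C, evalPoint_X]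
    · rw [mixedRel_eq]
      simp [elimBoth, evalPoint_C, evalPoint_X]
      norm_num
  intro d hd hd'
  have := hd.mul_right (-8)
  rw [elimBoth_vertRel] at this
  exact (hx.pow_left.mul_left ha) this hd'

lemma mem_of_pivot_mul_mem {p : FormRing} (h : pivot * p ∈ saitoIdeal) : p ∈ saitoIdeal := by
  obtain ⟨a, q, hq, h⟩ := Ideal.mem_span_insert.1 h
  obtain ⟨b, c, rfl⟩ := Ideal.mem_span_pair.1 hq
  have h1 := congrArg elimBoth h
  simp only [map_add, map_mul, elimBoth_eulerRel, elimBoth_pivot] at h1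
  obtain ⟨t, ht⟩ : elimBoth vertRel ∣ elimBoth c :=
    isRelPrime_elimBoth.dvd_of_dvd_mul_right
      ⟨-elimBoth b, by linear_combination -h1⟩
  have ht' := congrArg elimBoth ht
  rw [map_mul, elimBoth_elimBoth, elimBoth_elimBoth] at ht'
  obtain ⟨c₁, c₂, hc⟩ := exists_sub_elimBoth_eq (c - vertRel * t)
  rw [map_sub, map_mul, ← ht', sub_self, sub_zero] at hc
  have hb : elimBoth (b + t * mixedRel) = 0 := by
    refine (mul_eq_zero.1 ?_).resolve_right elimBoth_vertRel_ne_zero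
    rw [map_add, map_mul]
    linear_combination -h1 - elimBoth mixedRel * ht'
  obtain ⟨b₁, b₂, hb'⟩ := exists_sub_elimBoth_eq (b + t * mixedRel)
  rw [hb, sub_zero] at hb'
  have h2 : pivot * (p - c₂ * mixedRel - b₂ * vertRel)
      = (a + c₁ * mixedRel + b₁ * vertRel) * eulerRel := by
    linear_combination h - mixedRel * hc - vertRel * hb'
  have hp0 : elimPivot pivot = 0 := by
    simp only [elimPivot, pivot, map_sub, map_mul, map_ofNat, aeval_X, algHom_C, algebraMap_eq]
    change 8 * (C (C 8⁻¹) * C (X 0) * X 2) - C (X 0) * X 2 = 0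
    linear_combination C (X 0) * X 2 * eight_mul_C_C_inv
  have he : elimPivot eulerRel ≠ 0 := by
    intro h
    have := congrArg (evalPoint 1 ![0, 1, 0, 0]) h
    rw [eulerRel_eq] at this
    simp [elimPivot, evalPoint_C, evalPoint_X] at this
  have h3 := congrArg elimPivot h2
  rw [map_mul, map_mul, hp0, zero_mul, eq_comm, mul_eq_zero] at h3
  obtain ⟨w, hw⟩ := pivot_dvd_of_elimPivot_eq_zero (h3.resolve_right he)
  have hne : pivot ≠ 0 := by
    intro h
    have := congrArg (evalPoint 1 ![0, 0, 1, 0]) h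
    simp [pivot, evalPoint_C, evalPoint_X] at this
  have h4 : p - c₂ * mixedRel - b₂ * vertRel = w * eulerRel := by
    refine mul_left_cancel₀ hne ?_
    rw [h2, hw, mul_assoc]
  rw [show p = w * eulerRel + c₂ * mixedRel + b₂ * vertRel by linear_combination h4]
  exact add_mem (add_mem (Ideal.mul_mem_left _ _ eulerRel_mem)
    (Ideal.mul_mem_left _ _ mixedRel_mem)) (Ideal.mul_mem_left _ _ vertRel_mem)

end Pivot

/-- For the divisor `D_7`, with `g_j = ∂f_7/∂x_j`, one has
`ker φ = (ker^{(1)}φ : f_7)`: a polynomial `p ∈ A[s, ξ_1, ξ_2, ξ_3]` lies in `ker φ` if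
and only if `f_7·p ∈ ker^{(1)}φ` (here `f_7` is regarded as a constant polynomial). -/
theorem D7_ker_eq_colon :
    ∀ p : MvPolynomial (Fin 4) (MvPolynomial (Fin 3) ℂ),
      p ∈ RingHom.ker (reesPhi fD7 fun j => pderiv j fD7) ↔
        C fD7 * p ∈ kerOne fD7 fun j => pderiv j fD7 := by
  intro p
  constructor
  · intro hp
    obtain ⟨N, hN⟩ := exists_pow_pivot_mul_mem hp
    refine saitoIdeal_le_kerOne ?_
    induction N with
    | zero => simpa using hN
    | succ N ih => exact ih (mem_of_pivot_mul_mem (by rwa [← mul_assoc, ← pow_succ']))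
  · intro hp
    have h := kerOne_le_ker _ _ hp
    rw [RingHom.mem_ker, map_mul, reesPhi_C, mul_eq_zero, Polynomial.C_eq_zero] at h
    refine h.resolve_left fun h0 => ?_
    have := congrArg (eval ![1, 0, 1]) h0
    simp [fD7] at this
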